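/- The series ∑_{n=0}^∞ C(2n,n)² · P_n(353/272) · (17/2¹¹)^n · (44100n³ − 30420n² − 1559n − 206) converges to 8704/π. -/

import Mathlib

open Real Filter

/-- The Legendre polynomial of degree `n`, given by the explicit formula
`P_n(x) = 2^{-n} ∑_{j=0}^{n} C(n,j)^2 (x-1)^{n-j} (x+1)^j`. -/
noncomputable def legendreP (n : ℕ) (x : ℝ) : ℝ :=
  (2 : ℝ)⁻¹ ^ n *
    ∑ j ∈ Finset.range (n + 1), (n.choose j : ℝ) ^ 2 * (x - 1) ^ (n - j) * (x + 1) ^ j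

/-- The squared normalized central binomial coefficient `(C(2n,n) / 4^n)^2`. -/
noncomputable def ellipticCoeff (n : ℕ) : ℝ := ((n.centralBinom : ℝ) / 4 ^ n) ^ 2

lemma ellipticCoeff_zero : ellipticCoeff 0 = 1 := by simp [ellipticCoeff]

lemma ellipticCoeff_nonneg (n : ℕ) : 0 ≤ ellipticCoeff n := sq_nonneg _

lemma ellipticCoeff_succ (n : ℕ) :
    ((n : ℝ) + 1) ^ 2 * ellipticCoeff (n + 1) = ((n : ℝ) + 1 / 2) ^ 2 * ellipticCoeff n := by
  have h : ((n : ℝ) + 1) * ((n + 1).centralBinom : ℝ) = 2 * (2 * n + 1) * n.centralBinom := by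
    exact_mod_cast Nat.succ_mul_centralBinom_succ n
  unfold ellipticCoeff
  rw [← mul_pow, ← mul_pow, mul_div_assoc', h]
  congr 1
  rw [pow_succ]
  field_simp
  ring

lemma ellipticCoeff_le_one (n : ℕ) : ellipticCoeff n ≤ 1 := by
  induction n with
  | zero => simp [ellipticCoeff_zero]
  | succ n ih =>
    have h := ellipticCoeff_succ n
    have h0 := ellipticCoeff_nonneg n
    have hn : (0 : ℝ) ≤ n := n.cast_nonneg
    by_contra! hlt
    nlinarith [mul_pos (by positivity : (0 : ℝ) < ((n : ℝ) + 1) ^ 2) (sub_pos.2 hlt),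
      mul_nonneg (by positivity : (0 : ℝ) ≤ ((n : ℝ) + 1 / 2) ^ 2) (sub_nonneg.2 ih)]

lemma tendsto_mul_ellipticCoeff :
    Tendsto (fun n : ℕ => (n : ℝ) * ellipticCoeff n) atTop (nhds (1 / π)) := by
  have key : ∀ n : ℕ, (2 * (n : ℝ) + 1) * ellipticCoeff n = (Wallis.W n)⁻¹ := by
    intro n
    induction n with
    | zero => simp [ellipticCoeff_zero, Wallis.W]
    | succ n ih =>
      have h := ellipticCoeff_succ n
      have hW := Wallis.W_pos n
      rw [Wallis.W_succ, mul_inv, ← ih]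
      push_cast
      have : ellipticCoeff (n + 1) =
          ((n : ℝ) + 1 / 2) ^ 2 * ellipticCoeff n / ((n : ℝ) + 1) ^ 2 := by
        rw [← h]; field_simp
      rw [this]
      field_simp
      ring
  have h1 : Tendsto (fun n : ℕ => (n : ℝ) / (2 * n + 1)) atTop (nhds (1 / 2)) := by
    have h2 : Tendsto (fun n : ℕ => (1 : ℝ) / 2 - (1 / 2) * (1 / (2 * (n : ℝ) + 1))) atTop
        (nhds (1 / 2 - (1 / 2) * 0)) := by
      refine tendsto_const_nhds.sub (tendsto_const_nhds.mul ?_)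
      refine tendsto_const_nhds.div_atTop ?_
      exact tendsto_atTop_add_const_right _ _
        (tendsto_natCast_atTop_atTop.const_mul_atTop (by norm_num))
    simp only [mul_zero, sub_zero] at h2
    refine h2.congr fun n => ?_
    field_simp
    ring
  have h3 := h1.mul (Wallis.tendsto_W_nhds_pi_div_two.inv₀ (by positivity))
  have e : (1 : ℝ) / 2 * (π / 2)⁻¹ = 1 / π := by
    have := Real.pi_pos
    field_simp
  rw [e] at h3
  refine h3.congr fun n => ?_
  rw [← key]
  field_simp

lemma tendsto_ellipticCoeff : Tendsto ellipticCoeff atTop (nhds 0) := by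
  have h := tendsto_mul_ellipticCoeff.mul (tendsto_inv_atTop_nhds_zero_nat (𝕜 := ℝ))
  rw [mul_zero] at h
  refine h.congr' ?_
  filter_upwards [eventually_gt_atTop 0] with n hn
  have : (n : ℝ) ≠ 0 := by positivity
  field_simp

lemma summable_powerSeries {a : ℕ → ℝ} {k : ℕ} (ha : ∀ n, |a n| ≤ (n : ℝ) ^ k) {x : ℝ}
    (hx : |x| < 1) : Summable fun n => a n * x ^ n := by
  refine Summable.of_norm_bounded (g := fun n : ℕ => (n : ℝ) ^ k * |x| ^ n)
    (summable_pow_mul_geometric_of_norm_lt_one k (by simpa using hx)) fun n => ?_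
  rw [norm_mul, norm_pow, Real.norm_eq_abs, Real.norm_eq_abs]
  exact mul_le_mul_of_nonneg_right (ha n) (by positivity)

lemma hasDerivAt_powerSeries {a : ℕ → ℝ} {k : ℕ} (ha : ∀ n, |a n| ≤ (n : ℝ) ^ k) {x : ℝ}
    (hx : |x| < 1) :
    HasDerivAt (fun y => ∑' n, a n * y ^ n) (∑' n, a n * (n * x ^ (n - 1))) x := by
  obtain ⟨r, hxr, hr1⟩ := exists_between hx
  have hr0 : 0 < r := (abs_nonneg x).trans_lt hxr
  have hr : ‖r‖ < 1 := by rwa [Real.norm_eq_abs, abs_of_pos hr0]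
  have hu : Summable fun n : ℕ => r⁻¹ * ((n : ℝ) ^ (k + 1) * r ^ n) :=
    (summable_pow_mul_geometric_of_norm_lt_one (k + 1) hr).mul_left r⁻¹
  have hb : ∀ (n : ℕ) (y : ℝ), y ∈ Set.Ioo (-r) r →
      ‖a n * (n * y ^ (n - 1))‖ ≤ r⁻¹ * ((n : ℝ) ^ (k + 1) * r ^ n) := by
    intro n y hy
    have hy' : |y| ≤ r := (abs_lt.2 hy).le
    rcases n with _ | n
    · simp
    rw [norm_mul, norm_mul, norm_pow, Real.norm_eq_abs, Real.norm_eq_abs, Real.norm_eq_abs,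
      Nat.add_sub_cancel, Nat.abs_cast]
    calc |a (n + 1)| * (((n + 1 : ℕ) : ℝ) * |y| ^ n)
        ≤ ((n + 1 : ℕ) : ℝ) ^ k * (((n + 1 : ℕ) : ℝ) * r ^ n) := by
          gcongr
          exact ha _
      _ = r⁻¹ * (((n + 1 : ℕ) : ℝ) ^ (k + 1) * r ^ (n + 1)) := by
          rw [pow_succ r, pow_succ _ k]
          field_simp
  refine hasDerivAt_tsum_of_isPreconnected (g := fun n y => a n * y ^ n)
    (g' := fun n y => a n * (n * y ^ (n - 1))) (t := Set.Ioo (-r) r) hu isOpen_Ioo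
    isPreconnected_Ioo ?_ hb (abs_lt.1 hxr) (summable_powerSeries ha hx) (abs_lt.1 hxr)
  intro n y _
  exact (hasDerivAt_pow n y).const_mul (a n)

/-- The hypergeometric function `₂F₁(1/2, 1/2; 1; x)`. -/
noncomputable def ellipticF (x : ℝ) : ℝ := ∑' n, ellipticCoeff n * x ^ n

/-- The power series of `x * ellipticF' x`. -/
noncomputable def ellipticTheta (x : ℝ) : ℝ := ∑' n : ℕ, (n * ellipticCoeff n) * x ^ n

/-- The quasi-derivative `x * (1 - x) * ellipticF' x`. -/
noncomputable def ellipticG (x : ℝ) : ℝ := (1 - x) * ellipticTheta x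

lemma abs_pow_mul_ellipticCoeff_le (k n : ℕ) :
    |(n : ℝ) ^ k * ellipticCoeff n| ≤ (n : ℝ) ^ k := by
  rw [abs_of_nonneg (mul_nonneg (by positivity) (ellipticCoeff_nonneg n))]
  exact mul_le_of_le_one_right (by positivity) (ellipticCoeff_le_one n)

lemma abs_ellipticCoeff_le (n : ℕ) : |ellipticCoeff n| ≤ (n : ℝ) ^ 0 := by
  simpa using abs_pow_mul_ellipticCoeff_le 0 n

lemma abs_mul_ellipticCoeff_le (n : ℕ) : |(n : ℝ) * ellipticCoeff n| ≤ (n : ℝ) ^ 1 := by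
  simpa using abs_pow_mul_ellipticCoeff_le 1 n

lemma continuousAt_ellipticF {x : ℝ} (hx : |x| < 1) : ContinuousAt ellipticF x :=
  (hasDerivAt_powerSeries abs_ellipticCoeff_le hx).continuousAt

lemma continuousAt_ellipticG {x : ℝ} (hx : |x| < 1) : ContinuousAt ellipticG x :=
  ContinuousAt.mul (by fun_prop)
    (hasDerivAt_powerSeries abs_mul_ellipticCoeff_le hx).continuousAt

lemma ellipticF_zero : ellipticF 0 = 1 := by
  rw [ellipticF, tsum_eq_single 0 (fun n hn => by simp [hn])]
  simp [ellipticCoeff_zero]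

lemma ellipticTheta_zero : ellipticTheta 0 = 0 := by
  rw [ellipticTheta, tsum_eq_single 0 (fun n hn => by simp [hn])]
  simp

lemma ellipticG_zero : ellipticG 0 = 0 := by simp [ellipticG, ellipticTheta_zero]

lemma ellipticF_pos {x : ℝ} (h0 : 0 ≤ x) (h1 : x < 1) : 0 < ellipticF x := by
  refine (summable_powerSeries abs_ellipticCoeff_le
    (by rwa [abs_of_nonneg h0])).tsum_pos
    (fun n => mul_nonneg (ellipticCoeff_nonneg n) (by positivity)) 0 ?_
  simp [ellipticCoeff_zero]

lemma mul_tsum_deriv (a : ℕ → ℝ) (x : ℝ) :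
    x * ∑' n : ℕ, a n * (n * x ^ (n - 1)) = ∑' n : ℕ, (n * a n) * x ^ n := by
  rw [← tsum_mul_left]
  refine tsum_congr fun n => ?_
  rcases n with _ | n
  · simp
  · rw [Nat.add_sub_cancel, pow_succ]
    ring

lemma hasDerivAt_ellipticF {x : ℝ} (h0 : 0 < x) (h1 : x < 1) :
    HasDerivAt ellipticF (ellipticG x / (x * (1 - x))) x := by
  have hx : |x| < 1 := by rwa [abs_of_pos h0]
  refine (hasDerivAt_powerSeries abs_ellipticCoeff_le hx).congr_deriv ?_
  have h := mul_tsum_deriv ellipticCoeff x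
  have h2 : 1 - x ≠ 0 := by linarith
  rw [ellipticG, ellipticTheta, ← h]
  field_simp

lemma hasDerivAt_ellipticG {x : ℝ} (h0 : 0 < x) (h1 : x < 1) :
    HasDerivAt ellipticG (ellipticF x / 4) x := by
  have hx : |x| < 1 := by rwa [abs_of_pos h0]
  have hd := ((hasDerivAt_id x).const_sub 1).mul
    (hasDerivAt_powerSeries abs_mul_ellipticCoeff_le hx)
  refine hd.congr_deriv ?_
  have h := mul_tsum_deriv (fun n => n * ellipticCoeff n) x
  set D := ∑' n : ℕ, (n * ellipticCoeff n) * (n * x ^ (n - 1)) with hD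
  have s0 := summable_powerSeries abs_ellipticCoeff_le hx
  have s1 := summable_powerSeries abs_mul_ellipticCoeff_le hx
  have s2 := summable_powerSeries (abs_pow_mul_ellipticCoeff_le 2) hx
  have key : ∑' n : ℕ, (n : ℝ) ^ 2 * ellipticCoeff n * x ^ n =
      x * (∑' n : ℕ, (n : ℝ) ^ 2 * ellipticCoeff n * x ^ n + ellipticTheta x
        + 1 / 4 * ellipticF x) := by
    conv_lhs => rw [s2.tsum_eq_zero_add]
    rw [ellipticTheta, ellipticF, ← tsum_mul_left (a := (1 : ℝ) / 4), ← s2.tsum_add s1,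
      ← (s2.add s1).tsum_add (s0.mul_left _), ← tsum_mul_left]
    simp only [Nat.cast_zero, ne_eq, OfNat.ofNat_ne_zero, not_false_eq_true, zero_pow, zero_mul,
      zero_add]
    refine tsum_congr fun n => ?_
    push_cast
    rw [ellipticCoeff_succ, pow_succ]
    ring
  have h' : x * D = ∑' n : ℕ, (n : ℝ) ^ 2 * ellipticCoeff n * x ^ n := by
    rw [h]
    exact tsum_congr fun n => by ring
  rw [← h'] at key
  have key' : D = x * D + ellipticTheta x + 1 / 4 * ellipticF x :=
    mul_left_cancel₀ h0.ne' key
  change -1 * ellipticTheta x + (1 - x) * D = _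
  linarith

lemma eq_of_hasDerivAt_eq_zero {f : ℝ → ℝ} {b : ℝ} (hb : 0 ≤ b)
    (hc : ContinuousOn f (Set.Icc 0 b)) (hd : ∀ x ∈ Set.Ioo 0 b, HasDerivAt f 0 x) :
    f b = f 0 := by
  rcases hb.eq_or_lt with rfl | hb
  · rfl
  obtain ⟨c, -, h⟩ := exists_hasDerivAt_eq_slope f (fun _ => 0) hb hc hd
  rw [eq_div_iff (by linarith)] at h
  linarith

/-- Two solutions of the self-adjoint system `y' = p w`, `w' = q y` that are continuous at the
singular point `0`, where both quasi-derivatives vanish, are proportional. -/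
lemma proportional_of_system {y₁ y₂ w₁ w₂ p q : ℝ → ℝ} {b : ℝ} (hb : 0 ≤ b)
    (cy₁ : ContinuousOn y₁ (Set.Icc 0 b)) (cy₂ : ContinuousOn y₂ (Set.Icc 0 b))
    (cw₁ : ContinuousOn w₁ (Set.Icc 0 b)) (cw₂ : ContinuousOn w₂ (Set.Icc 0 b))
    (dy₁ : ∀ x ∈ Set.Ioo 0 b, HasDerivAt y₁ (p x * w₁ x) x)
    (dy₂ : ∀ x ∈ Set.Ioo 0 b, HasDerivAt y₂ (p x * w₂ x) x)
    (dw₁ : ∀ x ∈ Set.Ioo 0 b, HasDerivAt w₁ (q x * y₁ x) x)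
    (dw₂ : ∀ x ∈ Set.Ioo 0 b, HasDerivAt w₂ (q x * y₂ x) x)
    (hw₁ : w₁ 0 = 0) (hw₂ : w₂ 0 = 0) (hy : ∀ x ∈ Set.Icc 0 b, 0 < y₁ x) :
    y₁ 0 * y₂ b = y₂ 0 * y₁ b ∧ y₁ 0 * w₂ b = y₂ 0 * w₁ b := by
  have hW : ∀ x ∈ Set.Icc 0 b, y₁ x * w₂ x - w₁ x * y₂ x = 0 := by
    intro x hx
    have hsub : Set.Icc 0 x ⊆ Set.Icc 0 b := Set.Icc_subset_Icc_right hx.2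
    have h := eq_of_hasDerivAt_eq_zero (f := fun x => y₁ x * w₂ x - w₁ x * y₂ x) hx.1
      (((cy₁.mono hsub).mul (cw₂.mono hsub)).sub ((cw₁.mono hsub).mul (cy₂.mono hsub)))
      (fun t ht => by
        have ht' : t ∈ Set.Ioo 0 b := ⟨ht.1, ht.2.trans_le hx.2⟩
        refine (((dy₁ t ht').mul (dw₂ t ht')).sub ((dw₁ t ht').mul (dy₂ t ht'))).congr_deriv ?_
        ring)
    simpa [hw₁, hw₂] using h
  have hq := eq_of_hasDerivAt_eq_zero (f := fun x => y₂ x / y₁ x) hb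
    (cy₂.div cy₁ fun x hx => (hy x hx).ne')
    (fun t ht => by
      have ht' : t ∈ Set.Icc 0 b := ⟨ht.1.le, ht.2.le⟩
      refine ((dy₂ t ht).div (dy₁ t ht) (hy t ht').ne').congr_deriv ?_
      rw [div_eq_zero_iff]
      left
      linear_combination p t * hW t ht')
  have h0 := hy 0 ⟨le_rfl, hb⟩
  have h1 := hy b ⟨hb, le_rfl⟩
  have e1 : y₁ 0 * y₂ b = y₂ 0 * y₁ b := by
    rw [div_eq_div_iff h1.ne' h0.ne'] at hq
    linarith
  refine ⟨e1, mul_left_cancel₀ h1.ne' ?_⟩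
  linear_combination y₁ 0 * hW b ⟨hb, le_rfl⟩ + w₁ b * e1

/-- Ramanujan's cubic transformation of `ellipticF`, together with its derivative. -/
lemma ellipticF_cubic {p : ℝ} (h0 : 0 ≤ p) (h1 : p < 1) :
    ellipticF (p * (2 + p) ^ 3 / (1 + 2 * p) ^ 3) =
        (1 + 2 * p) * ellipticF (p ^ 3 * (2 + p) / (1 + 2 * p)) ∧
      2 * (1 + 2 * p) * ellipticG (p * (2 + p) ^ 3 / (1 + 2 * p) ^ 3) -
          2 * (p * (1 + p) * (2 + p) * (1 - p)) / (1 + 2 * p) ^ 2 *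
            ellipticF (p * (2 + p) ^ 3 / (1 + 2 * p) ^ 3) =
        6 * ellipticG (p ^ 3 * (2 + p) / (1 + 2 * p)) := by
  set u : ℝ → ℝ := fun p => p * (2 + p) ^ 3 / (1 + 2 * p) ^ 3 with hu
  set v : ℝ → ℝ := fun p => p ^ 3 * (2 + p) / (1 + 2 * p) with hv
  have u1 : ∀ t : ℝ, 0 ≤ t → 1 - u t = (1 + t) * (1 - t) ^ 3 / (1 + 2 * t) ^ 3 := by
    intro t ht
    have : 1 + 2 * t ≠ 0 := by positivity
    simp only [hu]
    field_simp
    ring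
  have v1 : ∀ t : ℝ, 0 ≤ t → 1 - v t = (1 + t) ^ 3 * (1 - t) / (1 + 2 * t) := by
    intro t ht
    have : 1 + 2 * t ≠ 0 := by positivity
    simp only [hv]
    field_simp
    ring
  have u_lt : ∀ t : ℝ, 0 ≤ t → t < 1 → u t < 1 := by
    intro t ht ht1
    have : 0 < 1 - t := by linarith
    have h : 0 < 1 - u t := by rw [u1 t ht]; positivity
    linarith
  have v_lt : ∀ t : ℝ, 0 ≤ t → t < 1 → v t < 1 := by
    intro t ht ht1
    have : 0 < 1 - t := by linarith
    have h : 0 < 1 - v t := by rw [v1 t ht]; positivity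
    linarith
  have u_nn : ∀ t : ℝ, 0 ≤ t → 0 ≤ u t := fun t ht => by simp only [hu]; positivity
  have v_nn : ∀ t : ℝ, 0 ≤ t → 0 ≤ v t := fun t ht => by simp only [hv]; positivity
  have cu : ∀ t : ℝ, 0 ≤ t → ContinuousAt u t := by
    intro t ht
    have : (1 + 2 * t) ^ 3 ≠ 0 := by positivity
    exact ContinuousAt.div (by fun_prop) (by fun_prop) this
  have cv : ∀ t : ℝ, 0 ≤ t → ContinuousAt v t := by
    intro t ht
    have : 1 + 2 * t ≠ 0 := by positivity
    exact ContinuousAt.div (by fun_prop) (by fun_prop) this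
  have du : ∀ t : ℝ, 0 < t → t < 1 → HasDerivAt u
      (u t * (1 - u t) * (2 * (1 + 2 * t) ^ 2 / (t * (1 + t) * (2 + t) * (1 - t)))) t := by
    intro t ht ht1
    have h3 : 1 - t ≠ 0 := by linarith
    have hd : (1 + 2 * t) ^ 3 ≠ 0 := by positivity
    refine (((hasDerivAt_id t).mul (((hasDerivAt_id t).const_add 2).pow 3)).div
      ((((hasDerivAt_id t).const_mul 2).const_add 1).pow 3) hd).congr_deriv ?_
    rw [u1 t ht.le]
    simp only [hu, id]
    field_simp
    simp
    ring
  have dv : ∀ t : ℝ, 0 < t → t < 1 → HasDerivAt v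
      (v t * (1 - v t) * (6 / (t * (1 + t) * (2 + t) * (1 - t)))) t := by
    intro t ht ht1
    have h3 : 1 - t ≠ 0 := by linarith
    have hd : 1 + 2 * t ≠ 0 := by positivity
    refine ((((hasDerivAt_id t).pow 3).mul ((hasDerivAt_id t).const_add 2)).div
      (((hasDerivAt_id t).const_mul 2).const_add 1) hd).congr_deriv ?_
    rw [v1 t ht.le]
    simp only [hv, id]
    field_simp
    simp
    ring
  have u_pos : ∀ t : ℝ, 0 < t → 0 < u t := fun t ht => by simp only [hu]; positivity
  have v_pos : ∀ t : ℝ, 0 < t → 0 < v t := fun t ht => by simp only [hv]; positivity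
  have aux : ∀ f : ℝ → ℝ, (∀ x : ℝ, |x| < 1 → ContinuousAt f x) → ∀ g : ℝ → ℝ,
      (∀ t : ℝ, 0 ≤ t → ContinuousAt g t) → (∀ t : ℝ, 0 ≤ t → t < 1 → g t < 1) →
      (∀ t : ℝ, 0 ≤ t → 0 ≤ g t) → ContinuousOn (fun t => f (g t)) (Set.Icc 0 p) := by
    intro f hf g hg hg1 hg0 t ht
    refine ContinuousAt.continuousWithinAt (ContinuousAt.comp (f := g) ?_ (hg t ht.1))
    refine hf _ ?_
    rw [abs_of_nonneg (hg0 t ht.1)]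
    exact hg1 t ht.1 (ht.2.trans_lt h1)
  have cF := fun x hx => @continuousAt_ellipticF x hx
  have cG := fun x hx => @continuousAt_ellipticG x hx
  have key := proportional_of_system (y₁ := fun t => ellipticF (v t))
    (y₂ := fun t => ellipticF (u t) / (1 + 2 * t))
    (w₁ := fun t => 6 * ellipticG (v t))
    (w₂ := fun t => 2 * (1 + 2 * t) * ellipticG (u t) -
      2 * (t * (1 + t) * (2 + t) * (1 - t)) / (1 + 2 * t) ^ 2 * ellipticF (u t))
    (p := fun t => 1 / (t * (1 + t) * (2 + t) * (1 - t)))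
    (q := fun t => 9 * t ^ 2 * (1 + t) ^ 2 / (1 + 2 * t) ^ 2) h0
    (aux _ cF v cv v_lt v_nn)
    ((aux _ cF u cu u_lt u_nn).div (by fun_prop) fun t ht => by have := ht.1; positivity)
    (continuousOn_const.mul (aux _ cG v cv v_lt v_nn))
    ((ContinuousOn.mul (by fun_prop) (aux _ cG u cu u_lt u_nn)).sub
      (ContinuousOn.mul (ContinuousOn.div (by fun_prop) (by fun_prop)
        fun t ht => by have := ht.1; positivity) (aux _ cF u cu u_lt u_nn)))
    ?_ ?_ ?_ ?_ ?_ ?_ ?_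
  · have hp : 1 + 2 * p ≠ 0 := by positivity
    obtain ⟨e1, e2⟩ := key
    have u0 : u 0 = 0 := by simp [hu]
    have v0 : v 0 = 0 := by simp [hv]
    simp only [u0, v0, ellipticF_zero] at e1 e2
    norm_num at e1 e2
    refine ⟨?_, e2⟩
    rw [div_eq_iff hp] at e1
    rw [e1]
    ring
  · intro t ht
    have ht1 := ht.2.trans h1
    refine ((hasDerivAt_ellipticF (v_pos t ht.1) (v_lt t ht.1.le ht1)).comp t
      (dv t ht.1 ht1)).congr_deriv ?_
    have n1 := (v_pos t ht.1).ne'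
    have n2 : 1 - v t ≠ 0 := by linarith [v_lt t ht.1.le ht1]
    field_simp
  · intro t ht
    have ht0 := ht.1
    have ht1 := ht.2.trans h1
    have hd : 1 + 2 * t ≠ 0 := by positivity
    have h3 : 1 - t ≠ 0 := by linarith
    refine (((hasDerivAt_ellipticF (u_pos t ht.1) (u_lt t ht.1.le ht1)).comp t
      (du t ht.1 ht1)).div (((hasDerivAt_id t).const_mul 2).const_add 1) hd).congr_deriv ?_
    have n1 := (u_pos t ht.1).ne'
    have n2 : 1 - u t ≠ 0 := by linarith [u_lt t ht.1.le ht1]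
    simp only [Function.comp_apply, id]
    field_simp
  · intro t ht
    have ht0 := ht.1
    have ht1 := ht.2.trans h1
    have h3 : 1 - t ≠ 0 := by linarith
    refine (((hasDerivAt_ellipticG (v_pos t ht.1) (v_lt t ht.1.le ht1)).comp t
      (dv t ht.1 ht1)).const_mul 6).congr_deriv ?_
    rw [v1 t ht.1.le]
    generalize ellipticF (v t) = E
    simp only [hv]
    field_simp
    ring
  · intro t ht
    have ht0 := ht.1
    have ht1 := ht.2.trans h1
    have hd : (1 + 2 * t) ^ 2 ≠ 0 := by positivity
    have h3 : 1 - t ≠ 0 := by linarith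
    have n1 := (u_pos t ht.1).ne'
    have n2 : 1 - u t ≠ 0 := by linarith [u_lt t ht.1.le ht1]
    have dG := (hasDerivAt_ellipticG (u_pos t ht.1) (u_lt t ht.1.le ht1)).comp t (du t ht.1 ht1)
    have dF := (hasDerivAt_ellipticF (u_pos t ht.1) (u_lt t ht.1.le ht1)).comp t (du t ht.1 ht1)
    have dlin := ((hasDerivAt_id t).const_mul 2).const_add 1
    have dnum := (((((hasDerivAt_id t).mul ((hasDerivAt_id t).const_add 1)).mul
      ((hasDerivAt_id t).const_add 2)).mul ((hasDerivAt_id t).const_sub 1)).const_mul 2)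
    refine (((dlin.const_mul 2).mul dG).sub
      ((dnum.div (dlin.pow 2) hd).mul dF)).congr_deriv ?_
    have e : ellipticG (u t) / (u t * (1 - u t)) *
        (u t * (1 - u t) * (2 * (1 + 2 * t) ^ 2 / (t * (1 + t) * (2 + t) * (1 - t)))) =
        ellipticG (u t) * (2 * (1 + 2 * t) ^ 2 / (t * (1 + t) * (2 + t) * (1 - t))) := by
      field_simp
    rw [e, u1 t ht.1.le]
    simp only [Function.comp_apply, id, Pi.mul_apply, Pi.pow_apply, Pi.div_apply]
    generalize ellipticF (u t) = E
    generalize ellipticG (u t) = E'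
    simp only [hu]
    field_simp
    simp
    ring
  · simp [hv, ellipticG_zero]
  · simp [hu, ellipticG_zero]
  · intro t ht
    exact ellipticF_pos (v_nn t ht.1) (v_lt t ht.1 (ht.2.trans_lt h1))

/-- Legendre's relation for `ellipticF`. -/
lemma legendre_relation {x : ℝ} (h0 : 0 < x) (h1 : x < 1) :
    ellipticF x * ellipticG (1 - x) + ellipticF (1 - x) * ellipticG x = 1 / π := by
  set L : ℝ → ℝ := fun x => ellipticF x * ellipticG (1 - x) + ellipticF (1 - x) * ellipticG x
    with hL
  have dL : ∀ t ∈ Set.Ioo (0 : ℝ) 1, HasDerivAt L 0 t := by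
    intro t ⟨ht0, ht1⟩
    have hs0 : 0 < 1 - t := by linarith
    have hs1 : 1 - t < 1 := by linarith
    have ds := (hasDerivAt_id t).const_sub 1
    refine (((hasDerivAt_ellipticF ht0 ht1).mul ((hasDerivAt_ellipticG hs0 hs1).comp t ds)).add
      (((hasDerivAt_ellipticF hs0 hs1).comp t ds).mul
        (hasDerivAt_ellipticG ht0 ht1))).congr_deriv ?_
    simp only [Function.comp_apply, sub_sub_cancel]
    have n1 : 1 - t ≠ 0 := hs0.ne'
    field_simp
    ring
  have hconst : ∀ t ∈ Set.Ioo (0 : ℝ) 1, L t = L x := by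
    intro t ht
    refine IsOpen.is_const_of_deriv_eq_zero isOpen_Ioo isPreconnected_Ioo
      (fun s hs => (dL s hs).differentiableAt.differentiableWithinAt)
      (fun s hs => (dL s hs).deriv) ht ⟨h0, h1⟩
  have abs_lt_one : ∀ t ∈ Set.Ioo (0 : ℝ) 1, |t| < 1 := fun t ht => by
    rw [abs_of_pos ht.1]
    exact ht.2
  have hmem : ∀ᶠ t in nhdsWithin (1 : ℝ) (Set.Iio 1), t ∈ Set.Ioo (0 : ℝ) 1 :=
    Ioo_mem_nhdsLT one_pos
  -- The backward difference of a null sequence gives a power series with an Abel limit.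
  have abel : ∀ (a : ℕ → ℝ) (l : ℝ) (k : ℕ), (∀ n, |a n| ≤ (n : ℝ) ^ k) →
      Tendsto a atTop (nhds l) →
      Tendsto (fun t => (1 - t) * ∑' n, a n * t ^ n) (nhdsWithin 1 (Set.Iio 1)) (nhds l) := by
    intro a l k ha hl
    set d : ℕ → ℝ := fun n => a n - if n = 0 then 0 else a (n - 1) with hd
    have hsum : ∀ n, ∑ i ∈ Finset.range (n + 1), d i = a n := by
      intro n
      induction n with
      | zero => simp [hd]
      | succ n ih => rw [Finset.sum_range_succ, ih]; simp [hd]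
    have hlim : Tendsto (fun n => ∑ i ∈ Finset.range n, d i) atTop (nhds l) := by
      rw [← tendsto_add_atTop_iff_nat 1]
      simpa only [hsum] using hl
    refine (Real.tendsto_tsum_powerSeries_nhdsWithin_lt hlim).congr' ?_
    filter_upwards [hmem] with t ht
    have hs := summable_powerSeries ha (abs_lt_one t ht)
    have hs' : Summable fun n => (if n = 0 then 0 else a (n - 1)) * t ^ n := by
      rw [← summable_nat_add_iff 1]
      refine (hs.mul_left t).congr fun n => ?_
      simp [pow_succ]
      ring
    have e : ∑' n, (if n = 0 then 0 else a (n - 1)) * t ^ n = t * ∑' n, a n * t ^ n := by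
      rw [hs'.tsum_eq_zero_add, ← tsum_mul_left]
      simp only [if_true, zero_mul, zero_add]
      refine tsum_congr fun n => ?_
      simp [pow_succ]
      ring
    simp only [hd, sub_mul]
    rw [hs.tsum_sub hs', e]
    ring
  have lim_theta := abel _ _ 1 abs_mul_ellipticCoeff_le tendsto_mul_ellipticCoeff
  have lim_F := abel _ _ 0 abs_ellipticCoeff_le tendsto_ellipticCoeff
  have hsub : Tendsto (fun t : ℝ => 1 - t) (nhdsWithin 1 (Set.Iio 1)) (nhds 0) := by
    have : Tendsto (fun t : ℝ => 1 - t) (nhds 1) (nhds (1 - 1)) :=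
      (continuous_const.sub continuous_id).tendsto 1
    rw [sub_self] at this
    exact this.mono_left nhdsWithin_le_nhds
  have limF0 : Tendsto (fun t => ellipticF (1 - t)) (nhdsWithin 1 (Set.Iio 1)) (nhds 1) := by
    have h := (continuousAt_ellipticF (x := 0) (by simp)).tendsto.comp hsub
    rwa [ellipticF_zero] at h
  obtain ⟨D, hD⟩ : ∃ D, HasDerivAt ellipticG D 0 :=
    ⟨_, ((hasDerivAt_id (0 : ℝ)).const_sub 1).mul
      (hasDerivAt_powerSeries abs_mul_ellipticCoeff_le (x := 0) (by simp))⟩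
  have limG0 : Tendsto (fun t => (1 - t)⁻¹ * ellipticG (1 - t)) (nhdsWithin 1 (Set.Iio 1))
      (nhds D) := by
    have hne : Tendsto (fun t : ℝ => 1 - t) (nhdsWithin 1 (Set.Iio 1)) (nhdsWithin 0 {0}ᶜ) := by
      refine tendsto_nhdsWithin_iff.2 ⟨hsub, ?_⟩
      filter_upwards [hmem] with t ht
      have : 1 - t ≠ 0 := by linarith [ht.2]
      simpa using this
    refine ((hasDerivAt_iff_tendsto_slope.1 hD).comp hne).congr fun t => ?_
    simp [slope_def_field, ellipticG_zero, div_eq_inv_mul]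
  have lim := (lim_F.mul limG0).add (limF0.mul lim_theta)
  rw [zero_mul, one_mul, zero_add] at lim
  refine tendsto_nhds_unique (lim.congr' ?_) tendsto_const_nhds |>.symm
  filter_upwards [hmem] with t ht
  change _ = L x
  rw [← hconst t ht]
  have n1 : 1 - t ≠ 0 := by linarith [ht.2]
  change (1 - t) * ellipticF t * _ + ellipticF (1 - t) * ellipticG t = _
  simp only [hL]
  field_simp

/-- The coefficients `(1/2)_{m+n}^2 / (m!^2 n!^2)` of Appell's double series `F₄`. -/
noncomputable def appellCoeff (p : ℕ × ℕ) : ℝ :=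
  ellipticCoeff (p.1 + p.2) * ((p.1 + p.2).choose p.1 : ℝ) ^ 2

/-- Appell's `F₄(1/2, 1/2; 1, 1; a (1 - b), b (1 - a))` with an additional weight `w` on its
terms. -/
noncomputable def appellSum (w : ℕ × ℕ → ℝ) (a b : ℝ) : ℝ :=
  ∑' p : ℕ × ℕ, w p * appellCoeff p * ((a * (1 - b)) ^ p.1 * (b * (1 - a)) ^ p.2)

lemma appellCoeff_nonneg (p : ℕ × ℕ) : 0 ≤ appellCoeff p :=
  mul_nonneg (ellipticCoeff_nonneg _) (sq_nonneg _)

lemma appellCoeff_swap (p : ℕ × ℕ) : appellCoeff p.swap = appellCoeff p := by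
  simp only [appellCoeff, Prod.fst_swap, Prod.snd_swap]
  rw [add_comm p.2 p.1, Nat.choose_symm_add]

lemma appellCoeff_le (p : ℕ × ℕ) : appellCoeff p ≤ 4 ^ p.1 * 4 ^ p.2 := by
  have h : ((p.1 + p.2).choose p.1 : ℝ) ≤ 2 ^ (p.1 + p.2) := by
    exact_mod_cast Nat.choose_le_two_pow _ _
  calc appellCoeff p ≤ 1 * (2 ^ (p.1 + p.2)) ^ 2 := by
        unfold appellCoeff
        gcongr
        exact ellipticCoeff_le_one _
    _ = 4 ^ p.1 * 4 ^ p.2 := by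
        rw [one_mul, ← pow_mul, mul_comm, pow_mul, ← pow_add]
        norm_num

lemma appellCoeff_succ_left (m n : ℕ) :
    ((m : ℝ) + 1) ^ 2 * appellCoeff (m + 1, n) =
      ((m : ℝ) + n + 1 / 2) ^ 2 * appellCoeff (m, n) := by
  have h1 := ellipticCoeff_succ (m + n)
  have h2 : ((m : ℝ) + n + 1) * ((m + n).choose m : ℝ) =
      ((m + n + 1).choose (m + 1) : ℝ) * (m + 1) := by
    exact_mod_cast Nat.add_one_mul_choose_eq (m + n) m
  simp only [appellCoeff]
  rw [show m + 1 + n = m + n + 1 by ring]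
  push_cast at h1
  calc ((m : ℝ) + 1) ^ 2 * (ellipticCoeff (m + n + 1) * ((m + n + 1).choose (m + 1) : ℝ) ^ 2)
      = ellipticCoeff (m + n + 1) * (((m + n + 1).choose (m + 1) : ℝ) * (m + 1)) ^ 2 := by ring
    _ = (((m : ℝ) + n + 1) ^ 2 * ellipticCoeff (m + n + 1)) * ((m + n).choose m : ℝ) ^ 2 := by
        rw [← h2]; ring
    _ = _ := by rw [h1]; ring

lemma summable_succ_pow_mul_geometric (k : ℕ) {q : ℝ} (h0 : 0 ≤ q) (h1 : q < 1) :
    Summable fun n : ℕ => ((n : ℝ) + 1) ^ k * q ^ n := by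
  obtain ⟨r, hqr, hr1⟩ := exists_between h1
  have hr0 : 0 < r := h0.trans_lt hqr
  have hr : ‖r‖ < 1 := by rwa [Real.norm_eq_abs, abs_of_pos hr0]
  have hs0 : Summable fun n : ℕ => (n : ℝ) ^ k * r ^ n :=
    summable_pow_mul_geometric_of_norm_lt_one k hr
  have hs := (summable_nat_add_iff 1).2 hs0
  refine Summable.of_nonneg_of_le (fun n => by positivity) (fun n => ?_) (hs.mul_left r⁻¹)
  push_cast
  calc ((n : ℝ) + 1) ^ k * q ^ n ≤ ((n : ℝ) + 1) ^ k * r ^ n := by gcongr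
    _ = r⁻¹ * (((n : ℝ) + 1) ^ k * r ^ (n + 1)) := by
        rw [pow_succ r]
        field_simp

/-- A majorant of the terms of `appellSum`. -/
noncomputable def appellMajorant (k : ℕ) (r s : ℝ) (p : ℕ × ℕ) : ℝ :=
  (((p.1 : ℝ) + 1) ^ k * (4 * r) ^ p.1) * (((p.2 : ℝ) + 1) ^ k * (4 * s) ^ p.2)

lemma summable_appellMajorant (k : ℕ) {r s : ℝ} (hr : 0 ≤ r) (hr' : r < 1 / 4) (hs : 0 ≤ s)
    (hs' : s < 1 / 4) : Summable (appellMajorant k r s) :=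
  (summable_succ_pow_mul_geometric k (by positivity) (by linarith)).mul_of_nonneg
    (summable_succ_pow_mul_geometric k (by positivity) (by linarith))
    (fun n => by positivity) (fun n => by positivity)

/-- The weight `w` is dominated by the `k`-th power of `(m + 1) (n + 1)`. -/
def WeightBound (k : ℕ) (w : ℕ × ℕ → ℝ) : Prop :=
  ∀ p, |w p| ≤ (((p.1 : ℝ) + 1) * ((p.2 : ℝ) + 1)) ^ k

lemma WeightBound.mul {k l : ℕ} {w v : ℕ × ℕ → ℝ} (hw : WeightBound k w) (hv : WeightBound l v) :
    WeightBound (k + l) fun p => w p * v p := fun p => by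
  rw [abs_mul, pow_add]
  exact mul_le_mul (hw p) (hv p) (abs_nonneg _) (by positivity)

lemma weightBound_one : WeightBound 0 fun _ => 1 := fun p => by simp

lemma weightBound_fst : WeightBound 1 fun p => (p.1 : ℝ) := fun p => by
  rw [Nat.abs_cast, pow_one]
  nlinarith [(p.1.cast_nonneg : (0 : ℝ) ≤ p.1), (p.2.cast_nonneg : (0 : ℝ) ≤ p.2),
    mul_nonneg (p.1.cast_nonneg : (0 : ℝ) ≤ p.1) (p.2.cast_nonneg : (0 : ℝ) ≤ p.2)]

lemma weightBound_snd : WeightBound 1 fun p => (p.2 : ℝ) := fun p => by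
  rw [Nat.abs_cast, pow_one]
  nlinarith [(p.1.cast_nonneg : (0 : ℝ) ≤ p.1), (p.2.cast_nonneg : (0 : ℝ) ≤ p.2),
    mul_nonneg (p.1.cast_nonneg : (0 : ℝ) ≤ p.1) (p.2.cast_nonneg : (0 : ℝ) ≤ p.2)]

lemma weightBound_add : WeightBound 1 fun p => (p.1 : ℝ) + p.2 := fun p => by
  rw [abs_of_nonneg (by positivity), pow_one]
  nlinarith [mul_nonneg (p.1.cast_nonneg : (0 : ℝ) ≤ p.1) (p.2.cast_nonneg : (0 : ℝ) ≤ p.2)]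

lemma norm_appell_term_le {k : ℕ} {w : ℕ × ℕ → ℝ} (hw : WeightBound k w) {x y r s : ℝ}
    (hx : 0 ≤ x) (hxr : x ≤ r) (hy : 0 ≤ y) (hys : y ≤ s) (p : ℕ × ℕ) :
    ‖w p * appellCoeff p * (x ^ p.1 * y ^ p.2)‖ ≤ appellMajorant k r s p := by
  rw [norm_mul, norm_mul, Real.norm_of_nonneg (appellCoeff_nonneg p),
    Real.norm_of_nonneg (by positivity : 0 ≤ x ^ p.1 * y ^ p.2), Real.norm_eq_abs]
  have := appellCoeff_nonneg p
  have hr : 0 ≤ r := hx.trans hxr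
  calc |w p| * appellCoeff p * (x ^ p.1 * y ^ p.2)
      ≤ (((p.1 : ℝ) + 1) * ((p.2 : ℝ) + 1)) ^ k * (4 ^ p.1 * 4 ^ p.2) * (r ^ p.1 * s ^ p.2) := by
        gcongr
        · exact hw p
        · exact appellCoeff_le p
    _ = appellMajorant k r s p := by
        unfold appellMajorant
        rw [mul_pow, mul_pow, mul_pow]
        ring

lemma mul_one_sub_nonneg {a b : ℝ} (ha : 0 ≤ a) (hb : b < 1 / 4) : 0 ≤ a * (1 - b) :=
  mul_nonneg ha (by linarith)

lemma mul_one_sub_le {a b : ℝ} (ha : 0 ≤ a) (hb : 0 ≤ b) : a * (1 - b) ≤ a :=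
  mul_le_of_le_one_right ha (by linarith)

lemma summable_appell {k : ℕ} {w : ℕ × ℕ → ℝ} (hw : WeightBound k w) {a b : ℝ}
    (ha : 0 ≤ a) (ha' : a < 1 / 4) (hb : 0 ≤ b) (hb' : b < 1 / 4) :
    Summable fun p : ℕ × ℕ =>
      w p * appellCoeff p * ((a * (1 - b)) ^ p.1 * (b * (1 - a)) ^ p.2) :=
  Summable.of_norm_bounded (summable_appellMajorant k ha ha' hb hb') fun p =>
    norm_appell_term_le hw (mul_one_sub_nonneg ha hb') (mul_one_sub_le ha hb)
      (mul_one_sub_nonneg hb ha') (mul_one_sub_le hb ha) p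

lemma continuousOn_appellSum {k : ℕ} {w : ℕ × ℕ → ℝ} (hw : WeightBound k w) {r b : ℝ}
    (hr : 0 ≤ r) (hr' : r < 1 / 4) (hb : 0 ≤ b) (hb' : b < 1 / 4) :
    ContinuousOn (fun a => appellSum w a b) (Set.Icc 0 r) :=
  continuousOn_tsum (fun p => by fun_prop) (summable_appellMajorant k hr hr' hb hb')
    fun p a ha => norm_appell_term_le hw (mul_one_sub_nonneg ha.1 hb')
      ((mul_one_sub_le ha.1 hb).trans ha.2) (mul_one_sub_nonneg hb (ha.2.trans_lt hr'))
      (mul_one_sub_le hb ha.1) p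

lemma hasDerivAt_appellSum {k : ℕ} {w : ℕ × ℕ → ℝ} (hw : WeightBound k w) {a b : ℝ}
    (ha : 0 < a) (ha' : a < 1 / 4) (hb : 0 ≤ b) (hb' : b < 1 / 4) :
    HasDerivAt (fun a => appellSum w a b)
      (((1 - a) * appellSum (fun p => w p * p.1) a b - a * appellSum (fun p => w p * p.2) a b) /
        (a * (1 - a))) a := by
  obtain ⟨r, har, hr⟩ := exists_between ha'
  have hr0 : 0 < r := ha.trans har
  set g : ℕ × ℕ → ℝ → ℝ := fun p a =>
    w p * appellCoeff p * ((a * (1 - b)) ^ p.1 * (b * (1 - a)) ^ p.2) with hg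
  set g' : ℕ × ℕ → ℝ → ℝ := fun p a =>
    (w p * ((1 - a) * p.1 - a * p.2)) * appellCoeff p *
      ((a * (1 - b)) ^ p.1 * (b * (1 - a)) ^ p.2) / (a * (1 - a)) with hg'
  have hmem : a ∈ Set.Ioo (a / 2) r := ⟨by linarith, har⟩
  have hd : ∀ p x, x ∈ Set.Ioo (a / 2) r → HasDerivAt (g p) (g' p x) x := by
    intro p x hx
    have hx0 : x ≠ 0 := by linarith [hx.1]
    have hx1 : 1 - x ≠ 0 := by linarith [hx.2]
    refine (((((hasDerivAt_id x).mul_const (1 - b)).pow p.1).mul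
      ((((hasDerivAt_id x).const_sub 1).const_mul b).pow p.2)).const_mul
      (w p * appellCoeff p)).congr_deriv ?_
    obtain ⟨m, n⟩ := p
    simp only [hg', id, Pi.pow_apply]
    rw [eq_div_iff (mul_ne_zero hx0 hx1)]
    rcases m with _ | m <;> rcases n with _ | n <;>
      simp only [Nat.add_sub_cancel, pow_succ, Nat.cast_zero, Nat.cast_add, Nat.cast_one] <;> ring
  have hbd : ∀ p x, x ∈ Set.Ioo (a / 2) r →
      ‖g' p x‖ ≤ (a / 2 * (1 - r))⁻¹ * appellMajorant (k + 1) r b p := by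
    intro p x hx
    have hx0 : 0 < x := by linarith [hx.1]
    have hx1 : x < 1 / 4 := by linarith [hx.2]
    have hv : WeightBound 1 fun p => (1 - x) * p.1 - x * p.2 := fun p => by
      refine le_trans ?_ (weightBound_add p)
      rw [abs_of_nonneg (by positivity : (0 : ℝ) ≤ (p.1 : ℝ) + p.2), abs_le]
      have h1 : (0 : ℝ) ≤ p.1 := p.1.cast_nonneg
      have h2 : (0 : ℝ) ≤ p.2 := p.2.cast_nonneg
      constructor <;> nlinarith [mul_nonneg hx0.le h1, mul_nonneg hx0.le h2]
    simp only [hg']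
    rw [norm_div, div_eq_inv_mul]
    have hden : a / 2 * (1 - r) ≤ ‖x * (1 - x)‖ := by
      rw [Real.norm_of_nonneg (mul_nonneg hx0.le (by linarith))]
      exact mul_le_mul hx.1.le (by linarith [hx.2]) (by linarith) hx0.le
    have hpos : 0 < a / 2 * (1 - r) := mul_pos (by linarith) (by linarith)
    refine mul_le_mul (inv_anti₀ hpos hden) ?_ (norm_nonneg _) (by positivity)
    exact norm_appell_term_le (hw.mul hv) (mul_one_sub_nonneg hx0.le hb')
      ((mul_one_sub_le hx0.le hb).trans hx.2.le) (mul_one_sub_nonneg hb hx1)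
      (mul_one_sub_le hb hx0.le) p
  have h := hasDerivAt_tsum_of_isPreconnected
    ((summable_appellMajorant (k + 1) hr0.le hr hb hb').mul_left (a / 2 * (1 - r))⁻¹)
    isOpen_Ioo isPreconnected_Ioo hd hbd hmem (summable_appell hw ha.le ha' hb hb') hmem
  refine h.congr_deriv ?_
  rw [appellSum, appellSum, ← tsum_mul_left, ← tsum_mul_left, ← Summable.tsum_sub
    ((summable_appell (hw.mul weightBound_fst) ha.le ha' hb hb').mul_left _)
    ((summable_appell (hw.mul weightBound_snd) ha.le ha' hb hb').mul_left _), ← tsum_div_const]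
  refine tsum_congr fun p => ?_
  simp only [hg']
  ring

lemma appellSum_swap (w : ℕ × ℕ → ℝ) (a b : ℝ) :
    appellSum (fun p => w p.swap) a b = appellSum w b a := by
  unfold appellSum
  rw [← (Equiv.prodComm ℕ ℕ).tsum_eq]
  refine tsum_congr fun p => ?_
  simp only [Equiv.prodComm_apply, appellCoeff_swap, Prod.swap_swap, Prod.fst_swap, Prod.snd_swap]
  ring

lemma appellSum_fst_sq {a b : ℝ} (ha : 0 ≤ a) (ha' : a < 1 / 4) (hb : 0 ≤ b) (hb' : b < 1 / 4) :
    appellSum (fun p => (p.1 : ℝ) * p.1) a b =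
      a * (1 - b) * appellSum (fun p => ((p.1 : ℝ) + p.2 + 1 / 2) ^ 2) a b := by
  have hinj : Function.Injective (fun p : ℕ × ℕ => (p.1 + 1, p.2)) := by
    rintro ⟨m, n⟩ ⟨m', n'⟩ h
    simpa using h
  have hsupp : ∀ p : ℕ × ℕ, p ∉ Set.range (fun p : ℕ × ℕ => (p.1 + 1, p.2)) →
      (p.1 : ℝ) * p.1 * appellCoeff p * ((a * (1 - b)) ^ p.1 * (b * (1 - a)) ^ p.2) = 0 := by
    rintro ⟨m, n⟩ h
    rcases m with _ | m
    · simp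
    · exact absurd ⟨(m, n), rfl⟩ h
  have hs := summable_appell (weightBound_fst.mul weightBound_fst) ha ha' hb hb'
  have h := (hinj.hasSum_iff hsupp).2 hs.hasSum
  rw [appellSum, ← h.tsum_eq, appellSum, ← tsum_mul_left]
  refine tsum_congr fun ⟨m, n⟩ => ?_
  have := appellCoeff_succ_left m n
  simp only [Function.comp_apply, pow_succ (a * (1 - b))]
  push_cast
  linear_combination ((a * (1 - b)) ^ m * (a * (1 - b))) * (b * (1 - a)) ^ n * this

lemma appellSum_snd_sq {a b : ℝ} (ha : 0 ≤ a) (ha' : a < 1 / 4) (hb : 0 ≤ b) (hb' : b < 1 / 4) :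
    appellSum (fun p => (p.2 : ℝ) * p.2) a b =
      b * (1 - a) * appellSum (fun p => ((p.1 : ℝ) + p.2 + 1 / 2) ^ 2) a b := by
  have h := appellSum_fst_sq hb hb' ha ha'
  rw [← appellSum_swap (fun p => (p.1 : ℝ) * p.1),
    ← appellSum_swap (fun p => ((p.1 : ℝ) + p.2 + 1 / 2) ^ 2)] at h
  simpa only [Prod.fst_swap, Prod.snd_swap, add_comm] using h

lemma appellSum_quadratic {a b : ℝ} (ha : 0 ≤ a) (ha' : a < 1 / 4) (hb : 0 ≤ b)
    (hb' : b < 1 / 4) :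
    appellSum (fun p => ((p.1 : ℝ) + p.2 + 1 / 2) ^ 2) a b =
      appellSum (fun p => (p.1 : ℝ) * p.1) a b + appellSum (fun p => (p.2 : ℝ) * p.2) a b +
        2 * appellSum (fun p => (p.1 : ℝ) * p.2) a b + appellSum (fun p => (p.1 : ℝ)) a b +
        appellSum (fun p => (p.2 : ℝ)) a b + 1 / 4 * appellSum (fun _ => 1) a b := by
  have h1 := (summable_appell (weightBound_fst.mul weightBound_fst) ha ha' hb hb').hasSum
  have h2 := (summable_appell (weightBound_snd.mul weightBound_snd) ha ha' hb hb').hasSum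
  have h3 := (summable_appell (weightBound_fst.mul weightBound_snd) ha ha' hb hb').hasSum
  have h4 := (summable_appell weightBound_fst ha ha' hb hb').hasSum
  have h5 := (summable_appell weightBound_snd ha ha' hb hb').hasSum
  have h6 := (summable_appell weightBound_one ha ha' hb hb').hasSum
  have h := ((((h1.add h2).add (h3.mul_left 2)).add h4).add h5).add (h6.mul_left (1 / 4))
  refine Eq.trans (tsum_congr fun p => ?_) h.tsum_eq
  ring

lemma appellSum_one_zero_left {a b : ℝ} (ha : 0 ≤ a) (ha' : a < 1 / 4) (hb : 0 ≤ b)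
    (hb' : b < 1 / 4) :
    appellSum (fun _ => 1) a b = appellSum (fun _ => 1) 0 b * ellipticF a := by
  have hlt : ∀ x ∈ Set.Ioo 0 a, x < 1 / 4 := fun x hx => hx.2.trans ha'
  have hle : ∀ x ∈ Set.Icc 0 a, |x| < 1 := fun x hx => by
    rw [abs_of_nonneg hx.1]
    linarith [hx.2]
  have key := proportional_of_system (y₁ := ellipticF) (w₁ := ellipticG)
    (y₂ := fun x => appellSum (fun _ => 1) x b)
    (w₂ := fun x => (1 - x) * appellSum (fun p => (p.1 : ℝ)) x b -
      x * appellSum (fun p => (p.2 : ℝ)) x b)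
    (p := fun x => 1 / (x * (1 - x))) (q := fun _ => 1 / 4) ha
    (fun x hx => (continuousAt_ellipticF (hle x hx)).continuousWithinAt)
    (continuousOn_appellSum weightBound_one ha ha' hb hb')
    (fun x hx => (continuousAt_ellipticG (hle x hx)).continuousWithinAt)
    ((ContinuousOn.mul (by fun_prop) (continuousOn_appellSum weightBound_fst ha ha' hb hb')).sub
      (ContinuousOn.mul (by fun_prop) (continuousOn_appellSum weightBound_snd ha ha' hb hb')))
    ?_ ?_ ?_ ?_ ellipticG_zero ?_ ?_
  · rw [ellipticF_zero, one_mul] at key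
    exact key.1
  · intro x hx
    refine (hasDerivAt_ellipticF hx.1 (by linarith [hlt x hx])).congr_deriv ?_
    ring
  · intro x hx
    refine (hasDerivAt_appellSum weightBound_one hx.1 (hlt x hx) hb hb').congr_deriv ?_
    simp only [one_mul]
    ring
  · intro x hx
    refine (hasDerivAt_ellipticG hx.1 (by linarith [hlt x hx])).congr_deriv ?_
    ring
  · intro x hx
    have hx' := hlt x hx
    have n0 : x ≠ 0 := hx.1.ne'
    have n1 : 1 - x ≠ 0 := by linarith
    refine ((((hasDerivAt_id x).const_sub 1).mul
      (hasDerivAt_appellSum weightBound_fst hx.1 hx' hb hb')).sub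
      ((hasDerivAt_id x).mul
        (hasDerivAt_appellSum weightBound_snd hx.1 hx' hb hb'))).congr_deriv ?_
    have e1 := appellSum_fst_sq hx.1.le hx' hb hb'
    have e2 := appellSum_snd_sq hx.1.le hx' hb hb'
    have e3 := appellSum_quadratic hx.1.le hx' hb hb'
    have e4 : appellSum (fun p => (p.2 : ℝ) * p.1) x b =
        appellSum (fun p => (p.1 : ℝ) * p.2) x b := by simp only [mul_comm]
    simp only [id, e4]
    generalize appellSum (fun p => ((p.1 : ℝ) + p.2 + 1 / 2) ^ 2) x b = K at *
    generalize appellSum (fun p => (p.1 : ℝ) * p.1) x b = M₁₁ at *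
    generalize appellSum (fun p => (p.2 : ℝ) * p.2) x b = M₂₂ at *
    field_simp
    subst e1 e2
    linear_combination (4 * x * (1 - x)) * e3
  · simp only [sub_zero, one_mul, zero_mul]
    unfold appellSum
    refine (tsum_congr fun p => ?_).trans tsum_zero
    obtain ⟨m, n⟩ := p
    rcases m with _ | m <;> simp
  · intro x hx
    exact ellipticF_pos hx.1 (by linarith [hx.2])

/-- Bailey's factorization of Appell's `F₄`. -/
lemma appellSum_one {a b : ℝ} (ha : 0 ≤ a) (ha' : a < 1 / 4) (hb : 0 ≤ b) (hb' : b < 1 / 4) :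
    appellSum (fun _ => 1) a b = ellipticF a * ellipticF b := by
  have h0 : appellSum (fun _ => 1) 0 0 = 1 := by
    rw [appellSum, tsum_eq_single (0, 0)]
    · simp [appellCoeff, ellipticCoeff_zero]
    · rintro ⟨m, n⟩ h
      rcases m with _ | m
      · rcases n with _ | n
        · exact absurd rfl h
        · simp
      · simp
  rw [appellSum_one_zero_left ha ha' hb hb', ← appellSum_swap,
    appellSum_one_zero_left hb hb' le_rfl (by norm_num), h0]
  ring

lemma appellSum_mul_add {k : ℕ} {w : ℕ × ℕ → ℝ} (hw : WeightBound k w)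
    (hsymm : ∀ p : ℕ × ℕ, w p.swap = w p) {D : ℝ → ℝ → ℝ}
    (hD : ∀ a ∈ Set.Ioo (0 : ℝ) (1 / 4), ∀ b ∈ Set.Ioo (0 : ℝ) (1 / 4),
      HasDerivAt (fun x => appellSum w x b) (D a b) a)
    {a b : ℝ} (ha : a ∈ Set.Ioo (0 : ℝ) (1 / 4)) (hb : b ∈ Set.Ioo (0 : ℝ) (1 / 4)) :
    appellSum (fun p => w p * ((p.1 : ℝ) + p.2)) a b =
      (a * (1 - a) * D a b + b * (1 - b) * D b a) / (1 - a - b) := by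
  have e1 := (hD a ha b hb).unique (hasDerivAt_appellSum hw ha.1 ha.2 hb.1.le hb.2)
  have e2 := (hD b hb a ha).unique (hasDerivAt_appellSum hw hb.1 hb.2 ha.1.le ha.2)
  rw [← appellSum_swap (fun p => w p * p.1) a b, ← appellSum_swap (fun p => w p * p.2) a b] at e2
  simp only [hsymm, Prod.fst_swap, Prod.snd_swap] at e2
  have h1 := (summable_appell (hw.mul weightBound_fst) ha.1.le ha.2 hb.1.le hb.2).hasSum
  have h2 := (summable_appell (hw.mul weightBound_snd) ha.1.le ha.2 hb.1.le hb.2).hasSum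
  have h : appellSum (fun p => w p * ((p.1 : ℝ) + p.2)) a b =
      appellSum (fun p => w p * p.1) a b + appellSum (fun p => w p * p.2) a b := by
    refine Eq.trans (tsum_congr fun p => ?_) (h1.add h2).tsum_eq
    ring
  obtain ⟨ha0, ha1⟩ := ha
  obtain ⟨hb0, hb1⟩ := hb
  have n1 : 1 - a ≠ 0 := by linarith
  have n2 : 1 - b ≠ 0 := by linarith
  have n3 : 1 - a - b ≠ 0 := by linarith
  rw [h, e1, e2]
  field_simp
  ring

lemma weightBound_add_pow (k : ℕ) : WeightBound k fun p => ((p.1 : ℝ) + p.2) ^ k := fun p => by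
  rw [abs_pow]
  exact pow_le_pow_left₀ (abs_nonneg _) (by simpa using weightBound_add p) k

/-- One application of the Euler operator to `appellSum`: the derivative `D` of a closed form `H`
in the first variable determines the sum with one more factor `m + n`. -/
lemma appellSum_add_pow_succ {k : ℕ} {H D : ℝ → ℝ → ℝ}
    (hH : ∀ a ∈ Set.Ioo (0 : ℝ) (1 / 4), ∀ b ∈ Set.Ioo (0 : ℝ) (1 / 4),
      appellSum (fun p => ((p.1 : ℝ) + p.2) ^ k) a b = H a b)
    (hD : ∀ a ∈ Set.Ioo (0 : ℝ) (1 / 4), ∀ b ∈ Set.Ioo (0 : ℝ) (1 / 4),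
      HasDerivAt (fun x => H x b) (D a b) a)
    {a b : ℝ} (ha : a ∈ Set.Ioo (0 : ℝ) (1 / 4)) (hb : b ∈ Set.Ioo (0 : ℝ) (1 / 4)) :
    appellSum (fun p => ((p.1 : ℝ) + p.2) ^ (k + 1)) a b =
      (a * (1 - a) * D a b + b * (1 - b) * D b a) / (1 - a - b) := by
  simp only [pow_succ]
  refine appellSum_mul_add (weightBound_add_pow k) (fun p => by simp [add_comm]) ?_ ha hb
  intro a ha b hb
  refine (hD a ha b hb).congr_of_eventuallyEq ?_
  filter_upwards [Ioo_mem_nhds ha.1 ha.2] with x hx using hH x hx b hb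

lemma appellSum_add_pow_one {a b : ℝ} (ha : a ∈ Set.Ioo (0 : ℝ) (1 / 4))
    (hb : b ∈ Set.Ioo (0 : ℝ) (1 / 4)) :
    appellSum (fun p => ((p.1 : ℝ) + p.2) ^ 1) a b =
      (ellipticG a * ellipticF b + ellipticF a * ellipticG b) / (1 - a - b) := by
  rw [appellSum_add_pow_succ (k := 0) (H := fun a b => ellipticF a * ellipticF b)
    (D := fun a b => ellipticG a / (a * (1 - a)) * ellipticF b) ?_ ?_ ha hb]
  · obtain ⟨ha0, ha1⟩ := ha
    obtain ⟨hb0, hb1⟩ := hb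
    have n1 : 1 - a ≠ 0 := by linarith
    have n2 : 1 - b ≠ 0 := by linarith
    have n3 : 1 - a - b ≠ 0 := by linarith
    field_simp
  · intro a ha b hb
    simpa only [pow_zero] using appellSum_one ha.1.le ha.2 hb.1.le hb.2
  · intro a ha b hb
    exact (hasDerivAt_ellipticF ha.1 (by linarith [ha.2])).mul_const _

lemma appellSum_add_pow_two {a b : ℝ} (ha : a ∈ Set.Ioo (0 : ℝ) (1 / 4))
    (hb : b ∈ Set.Ioo (0 : ℝ) (1 / 4)) :
    appellSum (fun p => ((p.1 : ℝ) + p.2) ^ 2) a b =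
      ((a * (1 - a) + b * (1 - b)) / 4 * (ellipticF a * ellipticF b) +
        2 * (ellipticG a * ellipticG b)) / (1 - a - b) ^ 2 +
      (ellipticG a * ellipticF b + ellipticF a * ellipticG b) *
        (a * (1 - a) + b * (1 - b)) / (1 - a - b) ^ 3 := by
  rw [appellSum_add_pow_succ (k := 1) (H := fun a b =>
      (ellipticG a * ellipticF b + ellipticF a * ellipticG b) / (1 - a - b))
    (D := fun a b => ((ellipticF a / 4 * ellipticF b +
      ellipticG a / (a * (1 - a)) * ellipticG b) * (1 - a - b) +
      (ellipticG a * ellipticF b + ellipticF a * ellipticG b)) / (1 - a - b) ^ 2) ?_ ?_ ha hb]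
  · obtain ⟨ha0, ha1⟩ := ha
    obtain ⟨hb0, hb1⟩ := hb
    have n1 : 1 - a ≠ 0 := by linarith
    have n2 : 1 - b ≠ 0 := by linarith
    have n3 : 1 - a - b ≠ 0 := by linarith
    have n4 : 1 - b - a ≠ 0 := by linarith
    rw [show 1 - b - a = 1 - a - b by ring]
    field_simp
    ring
  · intro a ha b hb
    exact appellSum_add_pow_one ha hb
  · intro a ha b hb
    have n3 : 1 - a - b ≠ 0 := by linarith [ha.2, hb.2]
    have dF := hasDerivAt_ellipticF ha.1 (by linarith [ha.2])
    have dG := hasDerivAt_ellipticG ha.1 (by linarith [ha.2])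
    refine (((dG.mul_const (ellipticF b)).add (dF.mul_const (ellipticG b))).div
      (((hasDerivAt_id a).const_sub 1).sub_const b) n3).congr_deriv ?_
    simp only [id, Pi.add_apply]
    ring

lemma appellSum_add_pow_three {a b : ℝ} (ha : a ∈ Set.Ioo (0 : ℝ) (1 / 4))
    (hb : b ∈ Set.Ioo (0 : ℝ) (1 / 4)) :
    appellSum (fun p => ((p.1 : ℝ) + p.2) ^ 3) a b =
      ((a * (1 - a) * (1 - 2 * a) + b * (1 - b) * (1 - 2 * b)) / (4 * (1 - a - b) ^ 3) +
        3 * (a * (1 - a) + b * (1 - b)) ^ 2 / (4 * (1 - a - b) ^ 4)) *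
          (ellipticF a * ellipticF b) +
      ((a * (1 - a) + 3 * (b * (1 - b))) / (4 * (1 - a - b) ^ 3) +
        (a * (1 - a) * (1 - 2 * a) + b * (1 - b) * (1 - 2 * b)) / (1 - a - b) ^ 4 +
        3 * (a * (1 - a) + b * (1 - b)) ^ 2 / (1 - a - b) ^ 5) * (ellipticG a * ellipticF b) +
      ((3 * (a * (1 - a)) + b * (1 - b)) / (4 * (1 - a - b) ^ 3) +
        (a * (1 - a) * (1 - 2 * a) + b * (1 - b) * (1 - 2 * b)) / (1 - a - b) ^ 4 +
        3 * (a * (1 - a) + b * (1 - b)) ^ 2 / (1 - a - b) ^ 5) * (ellipticF a * ellipticG b) +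
      6 * (a * (1 - a) + b * (1 - b)) / (1 - a - b) ^ 4 * (ellipticG a * ellipticG b) := by
  rw [appellSum_add_pow_succ (k := 2) (H := fun a b =>
      ((a * (1 - a) + b * (1 - b)) / 4 * (ellipticF a * ellipticF b) +
        2 * (ellipticG a * ellipticG b)) / (1 - a - b) ^ 2 +
      (ellipticG a * ellipticF b + ellipticF a * ellipticG b) *
        (a * (1 - a) + b * (1 - b)) / (1 - a - b) ^ 3)
    (D := fun a b =>
      ((1 - 2 * a) / 4 * (ellipticF a * ellipticF b) + (a * (1 - a) + b * (1 - b)) / 4 *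
        (ellipticG a / (a * (1 - a)) * ellipticF b) +
        2 * (ellipticF a / 4 * ellipticG b)) / (1 - a - b) ^ 2 +
      2 * ((a * (1 - a) + b * (1 - b)) / 4 * (ellipticF a * ellipticF b) +
        2 * (ellipticG a * ellipticG b)) / (1 - a - b) ^ 3 +
      ((ellipticF a / 4 * ellipticF b + ellipticG a / (a * (1 - a)) * ellipticG b) *
        (a * (1 - a) + b * (1 - b)) +
        (ellipticG a * ellipticF b + ellipticF a * ellipticG b) * (1 - 2 * a)) /
          (1 - a - b) ^ 3 +
      3 * ((ellipticG a * ellipticF b + ellipticF a * ellipticG b) *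
        (a * (1 - a) + b * (1 - b))) / (1 - a - b) ^ 4) ?_ ?_ ha hb]
  · obtain ⟨ha0, ha1⟩ := ha
    obtain ⟨hb0, hb1⟩ := hb
    have n1 : 1 - a ≠ 0 := by linarith
    have n2 : 1 - b ≠ 0 := by linarith
    have n3 : 1 - a - b ≠ 0 := by linarith
    rw [show 1 - b - a = 1 - a - b by ring]
    field_simp
    ring
  · intro a ha b hb
    exact appellSum_add_pow_two ha hb
  · intro a ha b hb
    have n3 : 1 - a - b ≠ 0 := by linarith [ha.2, hb.2]
    have n1 : 1 - a ≠ 0 := by linarith [ha.2]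
    have n0 : a ≠ 0 := ha.1.ne'
    have dF := hasDerivAt_ellipticF ha.1 (by linarith [ha.2])
    have dG := hasDerivAt_ellipticG ha.1 (by linarith [ha.2])
    have dR := ((hasDerivAt_id a).mul ((hasDerivAt_id a).const_sub 1)).add_const (b * (1 - b))
    have dρ := ((hasDerivAt_id a).const_sub 1).sub_const b
    refine (((((dR.div_const 4).mul (dF.mul_const (ellipticF b))).add
      ((dG.mul_const (ellipticG b)).const_mul 2)).div (dρ.pow 2) (pow_ne_zero 2 n3)).add
      ((((dG.mul_const (ellipticF b)).add (dF.mul_const (ellipticG b))).mul dR).div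
        (dρ.pow 3) (pow_ne_zero 3 n3))).congr_deriv ?_
    simp only [id, Pi.add_apply, Pi.mul_apply, Pi.pow_apply]
    field_simp
    simp
    ring

lemma choose_sq_mul_legendreP (N : ℕ) :
    ((2 * N).choose N : ℝ) ^ 2 * legendreP N (353 / 272) * (17 / 2 ^ 11) ^ N =
      ∑ p ∈ Finset.HasAntidiagonal.antidiagonal N,
        appellCoeff p * ((81 / 4096 : ℝ) ^ p.1 * (625 / 4096) ^ p.2) := by
  rw [legendreP, Finset.mul_sum, Finset.mul_sum, Finset.sum_mul,
    ← Finset.Nat.sum_antidiagonal_eq_sum_range_succ (fun i j => ((2 * N).choose N : ℝ) ^ 2 *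
      ((2 : ℝ)⁻¹ ^ N * ((N.choose i : ℝ) ^ 2 * (353 / 272 - 1) ^ j * (353 / 272 + 1) ^ i)) *
      (17 / 2 ^ 11) ^ N), ← Finset.Nat.sum_antidiagonal_swap]
  refine Finset.sum_congr rfl fun ⟨m, n⟩ h => ?_
  rw [Finset.HasAntidiagonal.mem_antidiagonal] at h
  subst h
  have e (c : ℝ) : (c / 4 ^ (m + n)) ^ 2 = c ^ 2 * (16⁻¹ ^ m * 16⁻¹ ^ n) := by
    rw [div_pow, ← pow_mul, mul_comm (m + n), pow_mul, ← pow_add, inv_pow, div_eq_mul_inv]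
    norm_num
  have eX : (81 / 4096 : ℝ) = 16 * (2⁻¹ * (353 / 272 - 1) * (17 / 2 ^ 11)) := by norm_num
  have eY : (625 / 4096 : ℝ) = 16 * (2⁻¹ * (353 / 272 + 1) * (17 / 2 ^ 11)) := by norm_num
  simp only [Prod.fst_swap, Prod.snd_swap, appellCoeff, ellipticCoeff, Nat.centralBinom, e]
  rw [← Nat.choose_symm_add, eX, eY]
  generalize (353 / 272 - 1 : ℝ) = A
  generalize (353 / 272 + 1 : ℝ) = B
  generalize (17 / 2 ^ 11 : ℝ) = t
  simp only [mul_pow, pow_add, inv_pow]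
  field_simp

lemma hasSum_nat_of_hasSum_add {f : ℕ × ℕ → ℝ} {q g : ℕ → ℝ} {s : ℝ}
    (h : HasSum (fun p : ℕ × ℕ => f p * q (p.1 + p.2)) s)
    (hg : ∀ N, g N = ∑ p ∈ Finset.HasAntidiagonal.antidiagonal N, f p) :
    HasSum (fun N => g N * q N) s := by
  refine HasSum.sigma
    ((Finset.HasAntidiagonal.sigmaAntidiagonalEquivProd (A := ℕ)).hasSum_iff.2 h) fun N => ?_
  rw [hg, Finset.sum_mul, ← Finset.sum_coe_sort]
  convert hasSum_fintype _ using 2 with p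
  have := Finset.HasAntidiagonal.mem_antidiagonal.1 p.2
  simp [Finset.HasAntidiagonal.sigmaAntidiagonalEquivProd, this]

/-- The values of `ellipticF` and `ellipticG` at `3 / 128` and `5 / 32` are linked by the
Legendre relation and the modular equation of degree three. -/
lemma ellipticF_ellipticG_relation :
    15 / 64 * (ellipticF (3 / 128) * ellipticF (5 / 32)) +
      2 * (ellipticG (3 / 128) * ellipticF (5 / 32)) +
      3 / 2 * (ellipticF (3 / 128) * ellipticG (5 / 32)) = 1 / π := by
  have h := legendre_relation (x := 3 / 128) (by norm_num) (by norm_num)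
  obtain ⟨h1, h2⟩ := ellipticF_cubic (p := 1 / 2) (by norm_num) (by norm_num)
  norm_num at h h1 h2
  rw [one_div, ← h]
  linear_combination (-ellipticG (3 / 128) - 15 / 128 * ellipticF (3 / 128)) * h1 -
    1 / 4 * ellipticF (3 / 128) * h2

theorem stmt4 :
    Tendsto (fun N => ∑ n ∈ Finset.range N,
      ((2 * n).choose n : ℝ) ^ 2 * legendreP n (353 / 272) * (17 / 2 ^ 11) ^ n *
        (44100 * (n : ℝ) ^ 3 - 30420 * (n : ℝ) ^ 2 - 1559 * (n : ℝ) - 206))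
      atTop (nhds (8704 / π)) := by
  have ha : (3 / 128 : ℝ) ∈ Set.Ioo (0 : ℝ) (1 / 4) := by constructor <;> norm_num
  have hb : (5 / 32 : ℝ) ∈ Set.Ioo (0 : ℝ) (1 / 4) := by constructor <;> norm_num
  have eX : (3 / 128 * (1 - 5 / 32) : ℝ) = 81 / 4096 := by norm_num
  have eY : (5 / 32 * (1 - 3 / 128) : ℝ) = 625 / 4096 := by norm_num
  have hs : ∀ k, HasSum (fun p : ℕ × ℕ => ((p.1 : ℝ) + p.2) ^ k * appellCoeff p *
      ((81 / 4096 : ℝ) ^ p.1 * (625 / 4096) ^ p.2))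
      (appellSum (fun p => ((p.1 : ℝ) + p.2) ^ k) (3 / 128) (5 / 32)) := by
    intro k
    have h := (summable_appell (weightBound_add_pow k) ha.1.le ha.2 hb.1.le hb.2).hasSum
    simp only [eX, eY] at h
    simpa only [appellSum, eX, eY] using h
  have s0 : appellSum (fun p => ((p.1 : ℝ) + p.2) ^ 0) (3 / 128) (5 / 32) =
      ellipticF (3 / 128) * ellipticF (5 / 32) := by
    simpa only [pow_zero] using appellSum_one ha.1.le ha.2 hb.1.le hb.2
  have h := ((((hs 3).mul_left 44100).sub ((hs 2).mul_left 30420)).sub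
    ((hs 1).mul_left 1559)).sub ((hs 0).mul_left 206)
  rw [appellSum_add_pow_three ha hb, appellSum_add_pow_two ha hb, appellSum_add_pow_one ha hb,
    s0] at h
  refine (hasSum_nat_of_hasSum_add (f := fun p =>
    appellCoeff p * ((81 / 4096 : ℝ) ^ p.1 * (625 / 4096) ^ p.2))
    (q := fun n => 44100 * (n : ℝ) ^ 3 - 30420 * (n : ℝ) ^ 2 - 1559 * (n : ℝ) - 206) ?_
    choose_sq_mul_legendreP).tendsto_sum_nat
  convert h using 1
  · rfl
  · funext p
    push_cast
    ring
  · linear_combination (-8704 : ℝ) * ellipticF_ellipticG_relation
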